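/- For any n ≥ 1 and any family A of subsets of [n] with |A| ≤ 2^{n-1}, we have f(A) := 2e(A) + |A ∩ Ā| ≤ 2F(|A|). -/

import Mathlib

open Finset

/-- Number of edges of the hypercube graph `Q_n` with both endpoints in `A`
(ordered pairs counted, then halved). -/
def edgeCount {n : ℕ} (A : Finset (Finset (Fin n))) : ℕ :=
  ((A ×ˢ A).filter (fun p => (symmDiff p.1 p.2).card = 1)).card / 2

/-- Number of edges of `Q_n` with exactly one endpoint in `A` (the edge boundary). -/
def edgeBoundary {n : ℕ} (A : Finset (Finset (Fin n))) : ℕ :=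
  ((A ×ˢ Aᶜ).filter (fun p => (symmDiff p.1 p.2).card = 1)).card

/-- Number of edges of `Q_n` with one endpoint in `X` and the other in `Y`. -/
def edgesBetween {n : ℕ} (X Y : Finset (Finset (Fin n))) : ℕ :=
  ((X ×ˢ Y).filter (fun p => (symmDiff p.1 p.2).card = 1)).card

/-- The antipodal image of a family: pointwise complementation in `[n]`. -/
def barFam {n : ℕ} (A : Finset (Finset (Fin n))) : Finset (Finset (Fin n)) :=
  A.image (fun x => xᶜ)

/-- Pointwise complementation within a ground set `s`. -/
def barOn {n : ℕ} (s : Finset (Fin n)) (A : Finset (Finset (Fin n))) :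
    Finset (Finset (Fin n)) :=
  A.image (fun x => s \ x)

/-- The upper `i`-section of `A`, as a family of subsets of `[n] \ {i}`. -/
def secUp {n : ℕ} (A : Finset (Finset (Fin n))) (i : Fin n) : Finset (Finset (Fin n)) :=
  Finset.univ.filter (fun x => i ∉ x ∧ insert i x ∈ A)

/-- The lower `i`-section of `A`, as a family of subsets of `[n] \ {i}`. -/
def secDown {n : ℕ} (A : Finset (Finset (Fin n))) (i : Fin n) : Finset (Finset (Fin n)) :=
  Finset.univ.filter (fun x => i ∉ x ∧ x ∈ A)

/-- The value of a subset of `[n]` in the binary ordering. -/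
def setToNat {n : ℕ} (x : Finset (Fin n)) : ℕ := ∑ i ∈ x, 2 ^ (i : ℕ)

/-- The initial segment of size `k` of the binary ordering on subsets of `[n]`
(for `k ≤ 2^n`). -/
def iseg (n k : ℕ) : Finset (Finset (Fin n)) :=
  Finset.univ.filter (fun x => setToNat x < k)

/-- `F k`: the number of hypercube edges induced by the initial segment of size `k`
of the binary ordering; equals the sum of binary digit sums of `0, …, k-1`. -/
def binF (k : ℕ) : ℕ := ∑ i ∈ Finset.range k, (Nat.digits 2 i).sum

/-- The subcube of subsets of `[n]` contained in the first `d` coordinates. -/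
def subcube (n d : ℕ) : Finset (Finset (Fin n)) :=
  Finset.univ.filter (fun x => ∀ i ∈ x, (i : ℕ) < d)

theorem binF_even (m : ℕ) : binF (2 * m) = 2 * binF m + m := by
  induction m with
  | zero => simp [binF]
  | succ k ih =>
    have h1 : binF (2 * (k + 1)) = binF (2 * k) + (Nat.digits 2 (2 * k)).sum
        + (Nat.digits 2 (2 * k + 1)).sum := by
      unfold binF
      rw [show 2 * (k + 1) = 2 * k + 1 + 1 by ring, Finset.sum_range_succ, Finset.sum_range_succ]
    have h2 : binF (k + 1) = binF k + (Nat.digits 2 k).sum := by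
      unfold binF
      rw [Finset.sum_range_succ]
    have h3 : (Nat.digits 2 (2 * k)).sum = (Nat.digits 2 k).sum := by
      rcases Nat.eq_zero_or_pos k with rfl | hk
      · simp
      · rw [Nat.digits_def' (by norm_num) (by omega)]
        simp
    have h4 : (Nat.digits 2 (2 * k + 1)).sum = (Nat.digits 2 k).sum + 1 := by
      rw [Nat.digits_def' (by norm_num) (by omega)]
      have : (2 * k + 1) / 2 = k := by omega
      rw [this, List.sum_cons]
      omega
    omega

theorem binF_odd (m : ℕ) : binF (2 * m + 1) = binF m + binF (m + 1) + m := by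
  have h1 : binF (2 * m + 1) = binF (2 * m) + (Nat.digits 2 (2 * m)).sum := by
    unfold binF
    rw [Finset.sum_range_succ]
  have h2 : binF (m + 1) = binF m + (Nat.digits 2 m).sum := by
    unfold binF
    rw [Finset.sum_range_succ]
  have h3 : (Nat.digits 2 (2 * m)).sum = (Nat.digits 2 m).sum := by
    rcases Nat.eq_zero_or_pos m with rfl | hk
    · simp
    · rw [Nat.digits_def' (by norm_num) (by omega)]
      simp
  have := binF_even m
  omega

theorem binF_zero : binF 0 = 0 := by simp [binF]

theorem binF_super (s : ℕ) : ∀ u b : ℕ, u + b = s → binF u + binF b + min u b ≤ binF (u + b) := by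
  induction s using Nat.strong_induction_on with
  | _ s ih =>
    intro u b hs
    rcases Nat.eq_zero_or_pos u with rfl | hu
    · simp [binF_zero]
    rcases Nat.eq_zero_or_pos b with rfl | hb
    · simp [binF_zero]
    obtain ⟨p, rfl | rfl⟩ := Nat.even_or_odd' u <;> obtain ⟨q, rfl | rfl⟩ := Nat.even_or_odd' b
    · have h := ih (p + q) (by omega) p q rfl
      rw [show 2 * p + 2 * q = 2 * (p + q) by ring, binF_even, binF_even, binF_even]
      omega
    · have h := ih (p + q) (by omega) p q rfl
      have h' := ih (p + (q + 1)) (by omega) p (q + 1) rfl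
      rw [show 2 * p + (2 * q + 1) = 2 * (p + q) + 1 by ring, binF_even, binF_odd, binF_odd]
      rw [← add_assoc] at h'
      omega
    · have h := ih (p + q) (by omega) p q rfl
      have h' := ih (p + 1 + q) (by omega) (p + 1) q rfl
      rw [show 2 * p + 1 + 2 * q = 2 * (p + q) + 1 by ring, binF_even, binF_odd, binF_odd]
      rw [show p + 1 + q = p + q + 1 by ring] at h'
      omega
    · have h := ih (p + (q + 1)) (by omega) p (q + 1) rfl
      have h' := ih (p + 1 + q) (by omega) (p + 1) q rfl
      rw [show 2 * p + 1 + (2 * q + 1) = 2 * (p + q + 1) by ring, binF_even, binF_odd, binF_odd]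
      rw [show p + 1 + q = p + q + 1 by ring] at h'
      rw [← add_assoc] at h
      omega

theorem binF_refl (k : ℕ) : ∀ x y : ℕ, x + y = 2 ^ k →
    2 * (binF x : ℤ) - 2 * binF y = k * ((x : ℤ) - y) := by
  induction k with
  | zero =>
    intro x y h
    have h1 : binF 1 = 0 := by simp [binF]
    have : (x = 0 ∧ y = 1) ∨ (x = 1 ∧ y = 0) := by omega
    rcases this with ⟨rfl, rfl⟩ | ⟨rfl, rfl⟩ <;> simp [h1, binF_zero]
  | succ k ih =>
    intro x y h
    rw [pow_succ] at h
    obtain ⟨p, rfl | rfl⟩ := Nat.even_or_odd' x <;> obtain ⟨q, rfl | rfl⟩ := Nat.even_or_odd' y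
    · have := ih p q (by omega)
      rw [binF_even, binF_even]
      push_cast
      linarith
    · omega
    · omega
    · have h1 := ih p (q + 1) (by omega)
      have h2 := ih (p + 1) q (by omega)
      rw [binF_odd, binF_odd]
      push_cast at *
      linarith

/-- Flip coordinate `i`. -/
def flipAt {n : ℕ} (i : Fin n) (x : Fin n → Bool) : Fin n → Bool := Function.update x i (!x i)

/-- Antipode. -/
def anti {n : ℕ} (x : Fin n → Bool) : Fin n → Bool := fun i => !x i

theorem flipAt_invol {n : ℕ} (i : Fin n) : Function.Involutive (flipAt i) := by
  intro x
  simp [flipAt]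

theorem anti_invol {n : ℕ} : Function.Involutive (anti (n := n)) := by
  intro x
  funext i
  simp [anti]

theorem sum_flipAt {n : ℕ} (i : Fin n) (h : (Fin n → Bool) → ℤ) :
    ∑ x, h (flipAt i x) = ∑ x, h x :=
  Equiv.sum_comp (flipAt_invol i).toPerm h

theorem sum_anti {n : ℕ} (h : (Fin n → Bool) → ℤ) :
    ∑ x, h (anti x) = ∑ x, h x :=
  Equiv.sum_comp (anti_invol (n := n)).toPerm h

/-- Ordered edge count. -/
def EE {n : ℕ} (g : (Fin n → Bool) → ℤ) : ℤ := ∑ i, ∑ x, g x * g (flipAt i x)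

theorem sum_cons_split {n : ℕ} (h : (Fin (n + 1) → Bool) → ℤ) :
    ∑ x, h x = ∑ y, h (Fin.cons false y) + ∑ y, h (Fin.cons true y) := by
  rw [← Equiv.sum_comp (Fin.consEquiv (fun _ : Fin (n + 1) => Bool)) h, Fintype.sum_prod_type]
  simp [Fin.consEquiv, add_comm]

theorem flip_zero {n : ℕ} (b : Bool) (y : Fin n → Bool) :
    flipAt 0 (Fin.cons b y : Fin (n + 1) → Bool) = Fin.cons (!b) y := by
  simp [flipAt]

theorem flip_succ {n : ℕ} (b : Bool) (i : Fin n) (y : Fin n → Bool) :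
    flipAt i.succ (Fin.cons b y : Fin (n + 1) → Bool) = Fin.cons b (flipAt i y) := by
  simp [flipAt, Fin.cons_update]

theorem anti_cons {n : ℕ} (b : Bool) (y : Fin n → Bool) :
    anti (Fin.cons b y : Fin (n + 1) → Bool) = Fin.cons (!b) (anti y) := by
  funext i
  refine Fin.cases ?_ (fun j => ?_) i <;> simp [anti]

theorem EE_split {n : ℕ} (g : (Fin (n + 1) → Bool) → ℤ) :
    EE g = EE (fun y => g (Fin.cons false y)) + EE (fun y => g (Fin.cons true y))
      + 2 * ∑ y, g (Fin.cons false y) * g (Fin.cons true y) := by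
  unfold EE
  rw [Fin.sum_univ_succ, sum_cons_split]
  simp only [sum_cons_split, flip_zero, flip_succ, Bool.not_false, Bool.not_true,
    Finset.sum_add_distrib]
  have : ∑ y : Fin n → Bool, g (Fin.cons true y) * g (Fin.cons false y)
      = ∑ y, g (Fin.cons false y) * g (Fin.cons true y) :=
    Finset.sum_congr rfl (fun _ _ => mul_comm _ _)
  rw [this]
  ring

theorem sum_mul_anti_comm {n : ℕ} (p q : (Fin n → Bool) → ℤ) :
    ∑ y, q y * p (anti y) = ∑ y, p y * q (anti y) := by
  rw [← sum_anti]
  refine Finset.sum_congr rfl (fun y _ => ?_)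
  rw [anti_invol y, mul_comm]

theorem anti_split {n : ℕ} (g : (Fin (n + 1) → Bool) → ℤ) :
    ∑ x, g x * g (anti x)
      = 2 * ∑ y, g (Fin.cons false y) * g (Fin.cons true (anti y)) := by
  rw [sum_cons_split]
  simp only [anti_cons, Bool.not_false, Bool.not_true]
  rw [sum_mul_anti_comm (fun y => g (Fin.cons false y)) (fun y => g (Fin.cons true y))]
  ring

theorem EE_compl {n : ℕ} (p : (Fin n → Bool) → ℤ) :
    EE p = EE (fun x => 1 - p x) + n * (2 * ∑ x, p x - 2 ^ n) := by
  have key : ∀ i : Fin n, ∑ x, p x * p (flipAt i x)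
      = ∑ x, (1 - p x) * (1 - p (flipAt i x)) + (2 * ∑ x, p x - 2 ^ n) := by
    intro i
    have h1 := sum_flipAt i p
    have h2 : ∑ x, (1 - p x) * (1 - p (flipAt i x))
        = ∑ x : Fin n → Bool, (1 : ℤ) - ∑ x, p x - ∑ x, p (flipAt i x)
          + ∑ x, p x * p (flipAt i x) := by
      rw [← Finset.sum_sub_distrib, ← Finset.sum_sub_distrib, ← Finset.sum_add_distrib]
      exact Finset.sum_congr rfl (fun _ _ => by ring)
    have h3 : ∑ x : Fin n → Bool, (1 : ℤ) = 2 ^ n := by simp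
    rw [h2, h1, h3]
    ring
  unfold EE
  rw [Finset.sum_congr rfl (fun i _ => key i), Finset.sum_add_distrib]
  simp [mul_sub]

/-- Induction hypothesis at dimension `m`. -/
def Good (m : ℕ) : Prop := ∀ (g : (Fin m → Bool) → ℤ) (k : ℕ), (∀ x, g x = 0 ∨ g x = 1) →
  ∑ x, g x = k → 2 * k ≤ 2 ^ m → EE g + ∑ x, g x * g (anti x) ≤ 2 * binF k

theorem step {m : ℕ} (hm : 1 ≤ m) (ih : Good m) (p q : (Fin m → Bool) → ℤ) (a b : ℕ)
    (hp : ∀ x, p x = 0 ∨ p x = 1) (hq : ∀ x, q x = 0 ∨ q x = 1)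
    (ha : ∑ x, p x = a) (hb : ∑ x, q x = b) (hba : b ≤ a) (hab : a + b ≤ 2 ^ m) :
    EE p + EE q + 2 * ∑ x, p x * q x + 2 * ∑ x, p x * q (anti x) ≤ 2 * binF (a + b) := by
  have fq := ih q b hq hb (by omega)
  have r1 : ∑ x, p (anti x) * q (anti x) = ∑ x, p x * q x := sum_anti (fun x => p x * q x)
  have r2 : ∑ x, p (anti x) * q x = ∑ x, p x * q (anti x) := by
    rw [← sum_mul_anti_comm]
    exact Finset.sum_congr rfl (fun _ _ => mul_comm _ _)
  have r3 := sum_anti q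
  have r4 := sum_anti p
  by_cases hc : 2 * a ≤ 2 ^ m
  · have fp := ih p a hp ha hc
    have hF := binF_super _ a b rfl
    rw [min_eq_right hba] at hF
    have hpt : ∑ x, (p x * q x + p (anti x) * q (anti x) + p x * q (anti x) + p (anti x) * q x)
        ≤ ∑ x, (p x * p (anti x) + q x * q (anti x) + q x + q (anti x)) := by
      refine Finset.sum_le_sum (fun x _ => ?_)
      rcases hp x with h1 | h1 <;> rcases hp (anti x) with h2 | h2 <;>
        rcases hq x with h3 | h3 <;> rcases hq (anti x) with h4 | h4 <;>
        simp [h1, h2, h3, h4]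
    simp only [Finset.sum_add_distrib] at hpt
    zify at hF
    linarith
  · obtain ⟨k, rfl⟩ : ∃ k, m = k + 1 := ⟨m - 1, by omega⟩
    have hpow : 2 ^ (k + 1) = 2 * 2 ^ k := by ring
    obtain ⟨c, hcc⟩ : ∃ c, a + c = 2 ^ (k + 1) := ⟨2 ^ (k + 1) - a, by omega⟩
    obtain ⟨u, hu⟩ : ∃ u, c + u = 2 ^ k := ⟨2 ^ k - c, by omega⟩
    obtain ⟨d, hd⟩ : ∃ d, b + d = c := ⟨c - b, by omega⟩
    have one : ∑ x : Fin (k + 1) → Bool, (1 : ℤ) = 2 ^ (k + 1) := by simp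
    have hcc' : (a : ℤ) + c = 2 ^ (k + 1) := by exact_mod_cast hcc
    have hsc : ∑ x, (1 - p x) = c := by
      rw [Finset.sum_sub_distrib, one, ha]
      linarith
    have fc := ih (fun x => 1 - p x) c (fun x => by rcases hp x with h | h <;> simp [h]) hsc
      (by omega)
    have hE := EE_compl p
    have hF := binF_super _ u b rfl
    have R1 := binF_refl (k + 1) (a + b) d (by omega)
    have R2 := binF_refl k c u hu
    have R3 := binF_refl k d (u + b) (by omega)
    have hpt0 : ∑ x : Fin (k + 1) → Bool, (0 : ℤ) ≤ ∑ x, (q x * q (anti x) + (1 - p x) * (1 - p (anti x))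
        + (q x + q (anti x)) * ((1 - p x) + (1 - p (anti x)))) := by
      refine Finset.sum_le_sum (fun x _ => ?_)
      rcases hp x with h1 | h1 <;> rcases hp (anti x) with h2 | h2 <;>
        rcases hq x with h3 | h3 <;> rcases hq (anti x) with h4 | h4 <;>
        simp [h1, h2, h3, h4]
    have hpt1 : ∑ x, (q x + q (anti x) + (1 - p x) + (1 - p (anti x)) - 1)
        ≤ ∑ x, (q x * q (anti x) + (1 - p x) * (1 - p (anti x))
        + (q x + q (anti x)) * ((1 - p x) + (1 - p (anti x)))) := by
      refine Finset.sum_le_sum (fun x _ => ?_)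
      rcases hp x with h1 | h1 <;> rcases hp (anti x) with h2 | h2 <;>
        rcases hq x with h3 | h3 <;> rcases hq (anti x) with h4 | h4 <;>
        simp [h1, h2, h3, h4]
    have ex : ∑ x, (q x * q (anti x) + (1 - p x) * (1 - p (anti x))
        + (q x + q (anti x)) * ((1 - p x) + (1 - p (anti x))))
        = ∑ x, q x * q (anti x) + ∑ x, (1 - p x) * (1 - p (anti x))
          + 4 * b - 2 * ∑ x, p x * q x - 2 * ∑ x, p x * q (anti x) := by
      have : ∑ x, (q x * q (anti x) + (1 - p x) * (1 - p (anti x))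
        + (q x + q (anti x)) * ((1 - p x) + (1 - p (anti x))))
        = ∑ x, q x * q (anti x) + ∑ x, (1 - p x) * (1 - p (anti x))
          + 2 * ∑ x, q x + 2 * ∑ x, q (anti x) - ∑ x, p x * q x - ∑ x, p (anti x) * q (anti x)
          - ∑ x, p x * q (anti x) - ∑ x, p (anti x) * q x := by
        simp only [Finset.mul_sum, ← Finset.sum_add_distrib, ← Finset.sum_sub_distrib]
        exact Finset.sum_congr rfl (fun _ _ => by ring)
      rw [this, r1, r2, r3, hb]
      ring
    have ex1 : ∑ x, (q x + q (anti x) + (1 - p x) + (1 - p (anti x)) - 1)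
        = 2 * b + 2 * c - 2 ^ (k + 1) := by
      have h5 : ∑ x, (1 - p (anti x)) = c := by
        rw [← hsc]
        exact sum_anti (fun x => 1 - p x)
      rw [Finset.sum_sub_distrib, Finset.sum_add_distrib, Finset.sum_add_distrib,
        Finset.sum_add_distrib, r3, hb, hsc, h5, one]
      ring
    rw [ex, ex1] at hpt1
    rw [ex] at hpt0
    simp only [Finset.sum_const_zero] at hpt0
    have hu' : (c : ℤ) + u = 2 ^ k := by exact_mod_cast hu
    have hd' : (b : ℤ) + d = c := by exact_mod_cast hd
    have hpow' : (2 : ℤ) ^ (k + 1) = 2 * 2 ^ k := by ring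
    have ha' : (a : ℤ) = 2 ^ (k + 1) - c := by linarith
    have hc' : (c : ℤ) = 2 ^ k - u := by linarith
    have hdd : (d : ℤ) = c - b := by linarith
    rw [ha] at hE
    push_cast at R1 R2 R3 hE
    simp only [ha', hdd, hc', hpow'] at R1 R2 R3 hE hpt1 hpt0 ⊢
    rcases le_total u b with h | h
    · rw [min_eq_left h] at hF
      zify at hF
      linarith
    · rw [min_eq_right h] at hF
      zify at hF
      linarith

theorem good_all (m : ℕ) : Good (m + 1) := by
  induction m with
  | zero =>
    intro g k hg hs hk
    have hs0 := hs
    rw [sum_cons_split] at hs0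
    rw [anti_split, EE_split]
    obtain ⟨d, hd⟩ : ∃ d : Fin 0 → Bool, ∀ h : (Fin 0 → Bool) → ℤ, ∑ x, h x = h d :=
      ⟨Fin.elim0, fun h => Fintype.sum_subsingleton h _⟩
    have e : anti d = d := Subsingleton.elim _ _
    simp only [EE, hd, e, Finset.univ_eq_empty, Finset.sum_empty] at hs0 ⊢
    rcases hg (Fin.cons false d) with h1 | h1 <;> rcases hg (Fin.cons true d) with h2 | h2 <;>
      rw [h1, h2] at hs0 ⊢ <;> simp <;> omega
  | succ m ih =>
    intro g k hg hs hk
    have hs0 := hs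
    rw [sum_cons_split] at hs0
    rw [anti_split, EE_split]
    have toN : ∀ h : (Fin (m + 1) → Bool) → ℤ, (∀ x, h x = 0 ∨ h x = 1) →
        ∃ a : ℕ, ∑ x, h x = a := by
      intro h hh
      refine ⟨(∑ x, h x).toNat, ?_⟩
      rw [Int.toNat_of_nonneg]
      exact Finset.sum_nonneg (fun x _ => by rcases hh x with h | h <;> simp [h])
    have hg0 : ∀ x : Fin (m + 1) → Bool, g (Fin.cons false x) = 0 ∨ g (Fin.cons false x) = 1 :=
      fun x => hg _
    have hg1 : ∀ x : Fin (m + 1) → Bool, g (Fin.cons true x) = 0 ∨ g (Fin.cons true x) = 1 :=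
      fun x => hg _
    obtain ⟨a, ha⟩ := toN _ hg0
    obtain ⟨b, hb⟩ := toN _ hg1
    rw [ha, hb] at hs0
    have hk' : a + b = k := by exact_mod_cast hs0
    rw [pow_succ] at hk
    subst hk'
    rcases le_total b a with h | h
    · have := step (by omega) ih _ _ a b hg0 hg1 ha hb h (by omega)
      linarith
    · have := step (by omega) ih _ _ b a hg1 hg0 hb ha h (by omega)
      rw [sum_mul_anti_comm (fun y => g (Fin.cons false y)) (fun y => g (Fin.cons true y))] at this
      have e : ∑ y : Fin (m + 1) → Bool, g (Fin.cons true y) * g (Fin.cons false y)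
          = ∑ y, g (Fin.cons false y) * g (Fin.cons true y) :=
        Finset.sum_congr rfl (fun _ _ => mul_comm _ _)
      rw [e, add_comm b a] at this
      linarith

/-- Subsets as Boolean vectors. -/
def toVec (n : ℕ) : Finset (Fin n) ≃ (Fin n → Bool) where
  toFun s := fun i => decide (i ∈ s)
  invFun v := Finset.univ.filter (fun i => v i = true)
  left_inv s := by ext i; simp
  right_inv v := by funext i; simp

theorem stmt10 (n : ℕ) (hn : 1 ≤ n) (A : Finset (Finset (Fin n)))
    (hA : A.card ≤ 2 ^ (n - 1)) :
    2 * edgeCount A + (A ∩ barFam A).card ≤ 2 * binF A.card := by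
  obtain ⟨m, rfl⟩ : ∃ m, n = m + 1 := ⟨n - 1, by omega⟩
  set ind : Finset (Fin (m + 1)) → ℤ := fun s => if s ∈ A then 1 else 0 with hind
  have hv : ∀ s i, flipAt i (toVec (m + 1) s) = toVec (m + 1) (symmDiff s {i}) := by
    intro s i
    funext j
    by_cases h : j = i
    · subst h
      simp [flipAt, toVec, Finset.mem_symmDiff]
    · simp [flipAt, toVec, Finset.mem_symmDiff, h]
  have hc : ∀ s, anti (toVec (m + 1) s) = toVec (m + 1) sᶜ := by
    intro s
    funext j
    simp [anti, toVec]
  have main := good_all m (fun v => ind ((toVec (m + 1)).symm v)) A.card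
    (fun x => by simp only [hind]; split_ifs <;> simp)
    (by
      rw [Equiv.sum_comp (toVec (m + 1)).symm ind]
      simp [hind])
    (by rw [pow_succ]; simp at hA; omega)
  have hEE : EE (fun v => ind ((toVec (m + 1)).symm v))
      = (((A ×ˢ A).filter (fun p => (symmDiff p.1 p.2).card = 1)).card : ℤ) := by
    unfold EE
    have h1 : ∀ i, ∑ x, ind ((toVec (m + 1)).symm x) * ind ((toVec (m + 1)).symm (flipAt i x))
        = ∑ s, ind s * ind (symmDiff s {i}) := by
      intro i
      rw [← Equiv.sum_comp (toVec (m + 1))]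
      simp [hv]
    simp only [h1]
    rw [← Finset.sum_product']
    have h2 : ∀ p : Fin (m + 1) × Finset (Fin (m + 1)), ind p.2 * ind (symmDiff p.2 {p.1})
        = if p.2 ∈ A ∧ symmDiff p.2 {p.1} ∈ A then 1 else 0 := by
      intro p
      simp only [hind]
      split_ifs <;> simp_all
    rw [Finset.sum_congr rfl (fun p _ => h2 p), Finset.sum_boole]
    congr 1
    refine Finset.card_bij (fun p _ => (p.2, symmDiff p.2 {p.1})) ?_ ?_ ?_
    · intro p hp
      simp at hp
      simp [hp]
    · rintro ⟨i, s⟩ _ ⟨j, t⟩ _ h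
      simp only [Prod.mk.injEq] at h
      obtain ⟨rfl, h⟩ := h
      have := symmDiff_right_injective s h
      simp at this
      simp [this]
    · rintro ⟨s, t⟩ h
      simp only [Finset.mem_filter, Finset.mem_product] at h
      obtain ⟨i, hi⟩ := Finset.card_eq_one.mp h.2
      refine ⟨(i, s), ?_, ?_⟩
      · simp [← hi, h.1]
      · simp [← hi]
  have hAA : ∑ x, ind ((toVec (m + 1)).symm x) * ind ((toVec (m + 1)).symm (anti x))
      = ((A ∩ barFam A).card : ℤ) := by
    rw [← Equiv.sum_comp (toVec (m + 1))]
    simp only [hc, Equiv.symm_apply_apply]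
    have h2 : ∀ s, ind s * ind sᶜ = if s ∈ A ∩ barFam A then 1 else 0 := by
      intro s
      have : s ∈ barFam A ↔ sᶜ ∈ A := by
        simp only [barFam, Finset.mem_image]
        constructor
        · rintro ⟨t, ht, rfl⟩
          simpa using ht
        · intro h
          exact ⟨_, h, by simp⟩
      simp only [hind, Finset.mem_inter, this]
      split_ifs <;> simp_all
    simp only [h2]
    rw [Finset.sum_boole, Finset.filter_univ_mem]
  rw [hEE, hAA] at main
  have main' : ((A ×ˢ A).filter (fun p => (symmDiff p.1 p.2).card = 1)).card
      + (A ∩ barFam A).card ≤ 2 * binF A.card := by exact_mod_cast main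
  unfold edgeCount
  omega
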